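/- arXiv:1602.01972 — 7 statements merged into one kernel-verified Lean document; each statement's English description precedes it below -/
import Mathlib

section
/- Let A = U − V be a proper splitting of a real m×n matrix A. Then: (a) A = U(I − U†V); (b) the n×n matrix I − U†V is invertible; and (c) A† = (I − U†V)⁻¹ U†. -/
open Matrix

/-- `G` is the Moore-Penrose inverse of `A` (the four Penrose equations). -/
def IsMoorePenrose {m n : ℕ} (A : Matrix (Fin m) (Fin n) ℝ)
    (G : Matrix (Fin n) (Fin m) ℝ) : Prop :=
  A * G * A = A ∧ G * A * G = G ∧ (A * G)ᵀ = A * G ∧ (G * A)ᵀ = G * A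

/-- `A = U - V` is a proper splitting: `range U = range A` and `null U = null A`. -/
def IsProperSplitting {m n : ℕ} (A U V : Matrix (Fin m) (Fin n) ℝ) : Prop :=
  A = U - V ∧
    LinearMap.range U.mulVecLin = LinearMap.range A.mulVecLin ∧
    LinearMap.ker U.mulVecLin = LinearMap.ker A.mulVecLin

/-- The spectral radius of a real square matrix: the maximum modulus of its
complex eigenvalues. -/
noncomputable def specRad {k : ℕ} (X : Matrix (Fin k) (Fin k) ℝ) : ℝ :=
  (spectralRadius ℂ (X.map Complex.ofReal)).toReal

/-- If `G` is an inner inverse of `U`, then `U * G` fixes every matrix whose range lies in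
that of `U`. -/
theorem mul_mul_eq_of_range_le {m n : ℕ} {A U : Matrix (Fin m) (Fin n) ℝ}
    {G : Matrix (Fin n) (Fin m) ℝ} (hG : U * G * U = U)
    (h : LinearMap.range A.mulVecLin ≤ LinearMap.range U.mulVecLin) : U * G * A = A := by
  refine Matrix.ext_of_mulVec_single fun i => ?_
  obtain ⟨y, hy⟩ := h ⟨Pi.single i 1, rfl⟩
  simp only [Matrix.mulVecLin_apply] at hy
  rw [← Matrix.mulVec_mulVec, ← hy, Matrix.mulVec_mulVec, hG]

/-- If `G` is an inner inverse of `U`, then `G * U` is a right unit for every matrix whose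
null space contains that of `U`. -/
theorem mul_mul_eq_of_ker_le {m n : ℕ} {A U : Matrix (Fin m) (Fin n) ℝ}
    {G : Matrix (Fin n) (Fin m) ℝ} (hG : U * G * U = U)
    (h : LinearMap.ker U.mulVecLin ≤ LinearMap.ker A.mulVecLin) : A * G * U = A := by
  refine Matrix.ext_of_mulVec_single fun i => ?_
  have hker : Pi.single i 1 - (G * U) *ᵥ Pi.single i 1 ∈ LinearMap.ker U.mulVecLin := by
    rw [LinearMap.mem_ker, Matrix.mulVecLin_apply, Matrix.mulVec_sub, Matrix.mulVec_mulVec,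
      ← Matrix.mul_assoc, hG, sub_self]
  have hA := h hker
  rw [LinearMap.mem_ker, Matrix.mulVecLin_apply, Matrix.mulVec_sub, Matrix.mulVec_mulVec,
    ← Matrix.mul_assoc, sub_eq_zero] at hA
  exact hA.symm

/-- Two symmetric matrices with `P * Q = P` and `Q * P = Q` coincide. -/
theorem eq_of_transpose_eq_of_mul_eq {k : ℕ} {P Q : Matrix (Fin k) (Fin k) ℝ}
    (hP : Pᵀ = P) (hQ : Qᵀ = Q) (hPQ : P * Q = P) (hQP : Q * P = Q) : P = Q := by
  have h := congrArg Matrix.transpose hPQ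
  rw [Matrix.transpose_mul, hP, hQ, hQP] at h
  exact h.symm

theorem stmt0 {m n : ℕ} (A U V : Matrix (Fin m) (Fin n) ℝ)
    (Ad Ud : Matrix (Fin n) (Fin m) ℝ)
    (hA : IsMoorePenrose A Ad) (hU : IsMoorePenrose U Ud)
    (hPS : IsProperSplitting A U V) :
    A = U * (1 - Ud * V) ∧
      IsUnit ((1 : Matrix (Fin n) (Fin n) ℝ) - Ud * V) ∧
      Ad = (1 - Ud * V)⁻¹ * Ud := by
  obtain ⟨hA1, hA2, hA3, hA4⟩ := hA
  obtain ⟨hU1, hU2, hU3, hU4⟩ := hU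
  obtain ⟨hAUV, hrange, hker⟩ := hPS
  have hUUdA : U * Ud * A = A := mul_mul_eq_of_range_le hU1 hrange.ge
  have hAAdU : A * Ad * U = U := mul_mul_eq_of_range_le hA1 hrange.le
  have hAUdU : A * Ud * U = A := mul_mul_eq_of_ker_le hU1 hker.le
  have hUAdA : U * Ad * A = U := mul_mul_eq_of_ker_le hA1 hker.ge
  have hrow : Ad * A = Ud * U := by
    refine eq_of_transpose_eq_of_mul_eq hA4 hU4 ?_ ?_
    · rw [Matrix.mul_assoc, ← Matrix.mul_assoc A, hAUdU]
    · rw [Matrix.mul_assoc, ← Matrix.mul_assoc U, hUAdA]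
  have hcol : A * Ad = U * Ud := by
    refine (eq_of_transpose_eq_of_mul_eq hU3 hA3 ?_ ?_).symm
    · have h : A * Ad * (U * Ud) = U * Ud := by rw [← Matrix.mul_assoc, hAAdU]
      simpa only [Matrix.transpose_mul (A * Ad), hA3, hU3] using congrArg Matrix.transpose h
    · have h : U * Ud * (A * Ad) = A * Ad := by rw [← Matrix.mul_assoc, hUUdA]
      simpa only [Matrix.transpose_mul (U * Ud), hA3, hU3] using congrArg Matrix.transpose h
  have hM : 1 - Ud * V = 1 - Ud * U + Ud * A := by
    rw [hAUV, Matrix.mul_sub]; abel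
  have hMAd : (1 - Ud * V) * Ad = Ud := by
    rw [hM, Matrix.add_mul, Matrix.sub_mul, Matrix.one_mul, ← hrow, hA2, sub_self, zero_add,
      Matrix.mul_assoc, hcol, ← Matrix.mul_assoc, hU2]
  have hMinv : (1 - Ud * V) * (1 - Ad * A + Ad * U) = 1 := by
    have hMrow : (1 - Ud * V) * (1 - Ad * A) = 1 - Ad * A := by
      have hAzero : Ud * A * (1 - Ad * A) = 0 := by
        rw [Matrix.mul_assoc, Matrix.mul_sub, Matrix.mul_one, ← Matrix.mul_assoc, hA1, sub_self,
          Matrix.mul_zero]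
      have hUzero : Ud * U * (1 - Ad * A) = 0 := by
        rw [Matrix.mul_assoc, Matrix.mul_sub, Matrix.mul_one, ← Matrix.mul_assoc, hUAdA, sub_self,
          Matrix.mul_zero]
      rw [hM, Matrix.add_mul, Matrix.sub_mul, Matrix.one_mul, hAzero, hUzero, sub_zero, add_zero]
    rw [Matrix.mul_add, hMrow, ← Matrix.mul_assoc, hMAd, hrow, sub_add_cancel]
  have hunit : IsUnit (1 - Ud * V) := IsUnit.of_mul_eq_one _ hMinv
  refine ⟨?_, hunit, ?_⟩
  · rw [hM, Matrix.mul_add, Matrix.mul_sub, Matrix.mul_one, ← Matrix.mul_assoc, hU1, sub_self,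
      zero_add, ← Matrix.mul_assoc, hUUdA]
  · have h := Matrix.nonsing_inv_mul_cancel_left (1 - Ud * V) Ad
      ((Matrix.isUnit_iff_isUnit_det _).mp hunit)
    rw [hMAd] at h
    exact h.symm
end

section
/- Let A = U − V be a proper splitting of a real m×n matrix A. Then both I + A†V (an n×n matrix) and I + VA† (an m×m matrix) are invertible. -/
open Matrix

theorem stmt1 {m n : ℕ} (A U V : Matrix (Fin m) (Fin n) ℝ)
    (Ad : Matrix (Fin n) (Fin m) ℝ)
    (hA : IsMoorePenrose A Ad)
    (hPS : IsProperSplitting A U V) :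
    IsUnit ((1 : Matrix (Fin n) (Fin n) ℝ) + Ad * V) ∧
      IsUnit ((1 : Matrix (Fin m) (Fin m) ℝ) + V * Ad) := by
  obtain ⟨hAGA, -, -, -⟩ := hA
  obtain ⟨hsub, hrange, hker⟩ := hPS
  have hV : V = U - A := by rw [hsub]; abel
  have hproj (x : Fin n → ℝ) : (A * Ad) *ᵥ (U *ᵥ x) = U *ᵥ x := by
    have hx : U *ᵥ x ∈ LinearMap.range A.mulVecLin := hrange ▸ ⟨x, rfl⟩
    obtain ⟨y, hy⟩ := hx
    rw [← hy, mulVecLin_apply, mulVec_mulVec, hAGA]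
  have hunit : IsUnit ((1 : Matrix (Fin n) (Fin n) ℝ) + Ad * V) := by
    rw [← mulVec_injective_iff_isUnit]
    refine (injective_iff_map_eq_zero (1 + Ad * V).mulVecLin).2 fun x hx => ?_
    rw [mulVecLin_apply] at hx
    have hAmul : A * (1 + Ad * V) = A * Ad * U := by
      rw [hV, Matrix.mul_sub, Matrix.mul_add, Matrix.mul_sub, Matrix.mul_one,
        ← Matrix.mul_assoc, ← Matrix.mul_assoc, hAGA]
      abel
    have hUx : U *ᵥ x = 0 := by
      rw [← hproj x, mulVec_mulVec, ← hAmul, ← mulVec_mulVec, hx, mulVec_zero]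
    have hAx : A *ᵥ x = 0 := by
      have hmem : x ∈ LinearMap.ker A.mulVecLin := hker ▸ LinearMap.mem_ker.2 hUx
      exact LinearMap.mem_ker.1 hmem
    rwa [hV, add_mulVec, one_mulVec, ← mulVec_mulVec, sub_mulVec, hUx, hAx, sub_zero,
      mulVec_zero, add_zero] at hx
  refine ⟨hunit, ?_⟩
  rw [isUnit_iff_isUnit_det] at hunit ⊢
  rwa [← det_one_add_mul_comm]
end

section
/- Let A = U − V be a proper splitting of a real m×n matrix A. Then every (complex) eigenvalue λ of A†V satisfies 1 + λ ≠ 0; moreover, for every eigenvalue μ of U†V there exists an eigenvalue λ of A†V with μ = λ/(1 + λ), and for every eigenvalue λ of A†V there exists an eigenvalue μ of U†V with λ = μ/(1 − μ). -/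
open Matrix

section SpectralMapping

variable {K R : Type*} [Field K] [Ring R] [Algebra K R] {a b : R}

theorem spectrum.one_add_ne_zero_of_isUnit (h : IsUnit (1 + a)) {l : K}
    (hl : l ∈ spectrum K a) : 1 + l ≠ 0 := by
  intro h0
  obtain rfl : l = -1 := by linear_combination h0
  refine hl ?_
  rw [spectrum.mem_resolventSet_iff, map_neg, map_one, ← neg_add']
  exact h.neg

theorem spectrum.div_one_add_mem (h₁ : (1 + a) * (1 - b) = 1) (h₂ : (1 - b) * (1 + a) = 1)
    {l : K} (hl : l ∈ spectrum K a) : l / (1 + l) ∈ spectrum K b := by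
  have ha : IsUnit (1 + a) := ⟨⟨1 + a, 1 - b, h₁, h₂⟩, rfl⟩
  have h0 : 1 + l ≠ 0 := spectrum.one_add_ne_zero_of_isUnit ha hl
  intro hb
  refine hl ?_
  have hu : IsUnit (algebraMap K R (1 + l)) := (IsUnit.mk0 _ h0).map _
  have hmul : algebraMap K R (1 + l) * algebraMap K R (l / (1 + l)) = algebraMap K R l := by
    rw [← map_mul, mul_div_cancel₀ l h0]
  have key : algebraMap K R l - a =
      algebraMap K R (1 + l) * (algebraMap K R (l / (1 + l)) - b) * (1 + a) := by
    have hba : b * (1 + a) = a := by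
      rw [sub_mul, one_mul, sub_eq_iff_eq_add] at h₂
      exact (add_left_cancel h₂).symm
    rw [mul_assoc, sub_mul, hba, mul_sub, ← mul_assoc, hmul, map_add, map_one]
    noncomm_ring
  rw [spectrum.mem_resolventSet_iff, key]
  exact (hu.mul hb).mul ha

theorem spectrum.div_one_sub_mem (h₁ : (1 + a) * (1 - b) = 1) (h₂ : (1 - b) * (1 + a) = 1)
    {μ : K} (hμ : μ ∈ spectrum K b) : μ / (1 - μ) ∈ spectrum K a := by
  have h := spectrum.div_one_add_mem (K := K) (a := -b) (b := -a) (l := -μ)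
    (by simpa [← sub_eq_add_neg] using h₂) (by simpa [← sub_eq_add_neg] using h₁)
    (by rw [← spectrum.neg_eq]; simpa using hμ)
  rw [← spectrum.neg_eq] at h
  simpa [neg_div, ← sub_eq_add_neg] using h

end SpectralMapping

section MoorePenrose

variable {m n : ℕ} {A U : Matrix (Fin m) (Fin n) ℝ} {Ad Ud : Matrix (Fin n) (Fin m) ℝ}

theorem IsMoorePenrose.mul_mul_eq_of_ker_le (hA : IsMoorePenrose A Ad)
    (h : LinearMap.ker A.mulVecLin ≤ LinearMap.ker U.mulVecLin) : U * (Ad * A) = U := by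
  refine Matrix.ext_of_mulVec_single fun i => ?_
  have hk : Pi.single i 1 - (Ad * A) *ᵥ Pi.single i 1 ∈ LinearMap.ker A.mulVecLin := by
    rw [LinearMap.mem_ker, mulVecLin_apply, mulVec_sub, mulVec_mulVec, ← Matrix.mul_assoc, hA.1,
      sub_self]
  have hU := h hk
  rw [LinearMap.mem_ker, mulVecLin_apply, mulVec_sub, mulVec_mulVec, sub_eq_zero] at hU
  exact hU.symm

theorem IsMoorePenrose.mul_mul_eq_of_range_le (hU : IsMoorePenrose U Ud)
    (h : LinearMap.range A.mulVecLin ≤ LinearMap.range U.mulVecLin) : U * Ud * A = A := by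
  refine Matrix.ext_of_mulVec_single fun i => ?_
  obtain ⟨z, hz⟩ := h ⟨Pi.single i 1, rfl⟩
  rw [mulVecLin_apply, mulVecLin_apply] at hz
  rw [← mulVec_mulVec, ← hz, mulVec_mulVec, hU.1]

theorem IsMoorePenrose.inv_mul_eq_of_ker_eq (hA : IsMoorePenrose A Ad) (hU : IsMoorePenrose U Ud)
    (h : LinearMap.ker U.mulVecLin = LinearMap.ker A.mulVecLin) : Ad * A = Ud * U := by
  have h₁ : Ud * U * (Ad * A) = Ud * U := by
    rw [Matrix.mul_assoc, hA.mul_mul_eq_of_ker_le h.ge]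
  have h₂ : Ad * A * (Ud * U) = Ad * A := by
    rw [Matrix.mul_assoc, hU.mul_mul_eq_of_ker_le h.le]
  have h₃ := congrArg transpose h₂
  rw [transpose_mul, hA.2.2.2, hU.2.2.2] at h₃
  exact h₃.symm.trans h₁

theorem IsMoorePenrose.mul_inv_eq_of_range_eq (hA : IsMoorePenrose A Ad)
    (hU : IsMoorePenrose U Ud)
    (h : LinearMap.range U.mulVecLin = LinearMap.range A.mulVecLin) : A * Ad = U * Ud := by
  have h₁ : U * Ud * (A * Ad) = A * Ad := by
    rw [← Matrix.mul_assoc, hU.mul_mul_eq_of_range_le h.ge]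
  have h₂ : A * Ad * (U * Ud) = U * Ud := by
    rw [← Matrix.mul_assoc, hA.mul_mul_eq_of_range_le h.le]
  have h₃ := congrArg transpose h₂
  rw [transpose_mul, hA.2.2.1, hU.2.2.1] at h₃
  exact h₁.symm.trans h₃

theorem IsProperSplitting.one_add_mul_one_sub {V : Matrix (Fin m) (Fin n) ℝ}
    (hA : IsMoorePenrose A Ad) (hU : IsMoorePenrose U Ud) (hPS : IsProperSplitting A U V) :
    (1 + Ad * V) * (1 - Ud * V) = 1 := by
  obtain ⟨hV, hr, hk⟩ := hPS
  have hP := hA.inv_mul_eq_of_ker_eq hU hk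
  have hQ := hA.mul_inv_eq_of_range_eq hU hr
  obtain rfl : V = U - A := by rw [hV, sub_sub_cancel]
  have e₁ : Ad * U * (Ud * U) = Ad * U := by
    rw [Matrix.mul_assoc, ← Matrix.mul_assoc U, hU.1]
  have e₂ : Ad * U * (Ud * A) = Ud * U := by
    rw [Matrix.mul_assoc, ← Matrix.mul_assoc U, ← hQ, hA.1, hP]
  have e₃ : Ud * U * (Ud * U) = Ud * U := by
    rw [← Matrix.mul_assoc, hU.2.1]
  have e₄ : Ud * U * (Ud * A) = Ud * A := by
    rw [← Matrix.mul_assoc, hU.2.1]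
  simp only [Matrix.mul_sub, Matrix.sub_mul, Matrix.add_mul, Matrix.mul_one, Matrix.one_mul, hP,
    e₁, e₂, e₃, e₄]
  abel

end MoorePenrose

theorem stmt2 {m n : ℕ} (A U V : Matrix (Fin m) (Fin n) ℝ)
    (Ad Ud : Matrix (Fin n) (Fin m) ℝ)
    (hA : IsMoorePenrose A Ad) (hU : IsMoorePenrose U Ud)
    (hPS : IsProperSplitting A U V) :
    (∀ l ∈ spectrum ℂ ((Ad * V).map Complex.ofReal), 1 + l ≠ 0) ∧
    (∀ μ ∈ spectrum ℂ ((Ud * V).map Complex.ofReal),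
        ∃ l ∈ spectrum ℂ ((Ad * V).map Complex.ofReal), μ = l / (1 + l)) ∧
    (∀ l ∈ spectrum ℂ ((Ad * V).map Complex.ofReal),
        ∃ μ ∈ spectrum ℂ ((Ud * V).map Complex.ofReal), l = μ / (1 - μ)) := by
  have h := congrArg Complex.ofRealHom.mapMatrix (hPS.one_add_mul_one_sub hA hU)
  rw [map_mul, map_add, map_sub, map_one] at h
  change (1 + (Ad * V).map Complex.ofReal) * (1 - (Ud * V).map Complex.ofReal) = 1 at h
  have h' := mul_eq_one_comm.mp h
  have hu : IsUnit (1 + (Ad * V).map Complex.ofReal) := ⟨⟨_, _, h, h'⟩, rfl⟩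
  have hne : ∀ l ∈ spectrum ℂ ((Ad * V).map Complex.ofReal), 1 + l ≠ 0 :=
    fun l hl => spectrum.one_add_ne_zero_of_isUnit hu hl
  refine ⟨hne, fun μ hμ => ?_, fun l hl => ?_⟩
  · have hl := spectrum.div_one_sub_mem h h' hμ
    refine ⟨_, hl, ?_⟩
    have hμ1 : 1 - μ ≠ 0 := by
      rw [sub_eq_add_neg]
      refine spectrum.one_add_ne_zero_of_isUnit (a := -(Ud * V).map Complex.ofReal) ?_ ?_
      · rw [← sub_eq_add_neg]
        exact ⟨⟨_, _, h', h⟩, rfl⟩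
      · rw [← spectrum.neg_eq]
        simpa using hμ
    field_simp
    ring
  · refine ⟨_, spectrum.div_one_add_mem h h' hl, ?_⟩
    have h0 := hne l hl
    field_simp
    ring
end

section
/- Let A = U − V be a proper weak regular splitting of a real m×n matrix A. Then A† ≥ 0 if and only if ρ(U†V) < 1. -/
open Matrix

open Filter Topology

/-- In a complex Banach algebra, spectral radius less than one forces the powers to vanish. -/
theorem tendsto_pow_zero_of_spectralRadius_lt_one {R : Type*} [NormedRing R]
    [NormedAlgebra ℂ R] [CompleteSpace R] {a : R} (ha : spectralRadius ℂ a < 1) :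
    Tendsto (fun k : ℕ => a ^ k) atTop (𝓝 0) := by
  obtain ⟨s, hs, hs1⟩ := ENNReal.lt_iff_exists_nnreal_btwn.1 ha
  have hs1' : s < 1 := by exact_mod_cast hs1
  have h := (spectrum.pow_nnnorm_pow_one_div_tendsto_nhds_spectralRadius a).eventually_lt_const hs
  have hpow : Tendsto (fun k : ℕ => (s : ℝ) ^ k) atTop (𝓝 0) :=
    tendsto_pow_atTop_nhds_zero_of_lt_one s.2 (by exact_mod_cast hs1')
  refine squeeze_zero_norm' ?_ hpow
  filter_upwards [h, eventually_gt_atTop 0] with k hk hk0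
  have hk0' : (0 : ℝ) < k := by exact_mod_cast hk0
  rw [one_div, ENNReal.rpow_inv_lt_iff hk0', ENNReal.rpow_natCast] at hk
  exact_mod_cast hk.le

/-- In a complex Banach algebra, an element whose powers vanish has spectral radius less
than one. -/
theorem spectralRadius_lt_one_of_tendsto_pow_zero {R : Type*} [NormedRing R]
    [NormedAlgebra ℂ R] [CompleteSpace R] [Nontrivial R] {a : R}
    (ha : Tendsto (fun k : ℕ => a ^ k) atTop (𝓝 0)) : spectralRadius ℂ a < 1 := by
  obtain ⟨z, hz, hzr⟩ := spectrum.exists_nnnorm_eq_spectralRadius a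
  rw [← hzr]
  have hpow : Tendsto (fun k : ℕ => z ^ k) atTop (𝓝 0) := by
    have hb : Tendsto (fun k : ℕ => ‖a ^ k‖ * ‖(1 : R)‖) atTop (𝓝 0) := by
      simpa using ha.norm.mul_const ‖(1 : R)‖
    exact squeeze_zero_norm
      (fun k => spectrum.norm_le_norm_mul_of_mem (spectrum.pow_mem_pow a k hz)) hb
  have : ‖z‖ < 1 := tendsto_pow_atTop_nhds_zero_iff_norm_lt_one.1 hpow
  exact_mod_cast this

section

attribute [local instance] Matrix.linftyOpNormedRing Matrix.linftyOpNormedAlgebra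

/-- The spectral radius of a real matrix is less than one iff its powers tend to zero. -/
theorem specRad_lt_one_iff_tendsto_pow {n : ℕ} (X : Matrix (Fin n) (Fin n) ℝ) :
    specRad X < 1 ↔ ∀ i j, Tendsto (fun k : ℕ => (X ^ k) i j) atTop (𝓝 0) := by
  rcases Nat.eq_zero_or_pos n with rfl | hn
  · refine ⟨fun _ i => i.elim0, fun _ => ?_⟩
    have : X.map Complex.ofReal = 0 := Subsingleton.elim _ _
    simp [specRad, this]
  have : Nonempty (Fin n) := ⟨⟨0, hn⟩⟩
  set Y := X.map Complex.ofReal with hY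
  have hpow (k : ℕ) : Y ^ k = (X ^ k).map Complex.ofReal :=
    (Matrix.map_pow X Complex.ofRealHom k).symm
  have hentry : Tendsto (fun k : ℕ => Y ^ k) atTop (𝓝 0) ↔
      ∀ i j, Tendsto (fun k : ℕ => (X ^ k) i j) atTop (𝓝 0) := by
    have h1 : Tendsto (fun k : ℕ => Y ^ k) atTop (𝓝 0) ↔
        ∀ i j, Tendsto (fun k : ℕ => (Y ^ k) i j) atTop (𝓝 0) :=
      tendsto_pi_nhds.trans (forall_congr' fun i => tendsto_pi_nhds)
    rw [h1]
    refine forall_congr' fun i => forall_congr' fun j => ?_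
    rw [tendsto_zero_iff_norm_tendsto_zero,
      tendsto_zero_iff_norm_tendsto_zero (f := fun k : ℕ => (X ^ k) i j)]
    simp [hpow]
  have hfin : spectralRadius ℂ Y ≠ ⊤ := by
    obtain ⟨z, -, hz⟩ := spectrum.exists_nnnorm_eq_spectralRadius Y
    simp [← hz]
  rw [← hentry]
  have hlt : specRad X < 1 ↔ spectralRadius ℂ Y < 1 := by
    rw [specRad, ← ENNReal.toReal_one, ENNReal.toReal_lt_toReal hfin ENNReal.one_ne_top]
  rw [hlt]
  exact ⟨tendsto_pow_zero_of_spectralRadius_lt_one, spectralRadius_lt_one_of_tendsto_pow_zero⟩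

end

theorem mul_eq_zero_of_ker_le {m n p : ℕ} {A U : Matrix (Fin m) (Fin n) ℝ}
    (h : LinearMap.ker U.mulVecLin ≤ LinearMap.ker A.mulVecLin)
    {B : Matrix (Fin n) (Fin p) ℝ} (hB : U * B = 0) : A * B = 0 := by
  refine Matrix.ext_of_mulVec_single fun i => ?_
  have hU : U *ᵥ (B *ᵥ Pi.single i 1) = 0 := by
    rw [Matrix.mulVec_mulVec, hB, Matrix.zero_mulVec]
  have hA : A *ᵥ (B *ᵥ Pi.single i 1) = 0 := h hU
  rw [← Matrix.mulVec_mulVec, hA, Matrix.zero_mulVec]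

/-- The projections `G * A` attached to Moore-Penrose inverses depend only on the null space. -/
theorem IsMoorePenrose.left_proj_eq {m n : ℕ} {A U : Matrix (Fin m) (Fin n) ℝ}
    {Ad Ud : Matrix (Fin n) (Fin m) ℝ} (hA : IsMoorePenrose A Ad) (hU : IsMoorePenrose U Ud)
    (h : LinearMap.ker U.mulVecLin = LinearMap.ker A.mulVecLin) : Ud * U = Ad * A := by
  obtain ⟨hA1, -, -, hA4⟩ := hA
  obtain ⟨hU1, -, -, hU4⟩ := hU
  have h1 : A * (Ud * U) = A := by
    have := mul_eq_zero_of_ker_le h.le (B := Ud * U - 1)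
      (by rw [Matrix.mul_sub, ← Matrix.mul_assoc, hU1, Matrix.mul_one, sub_self])
    rwa [Matrix.mul_sub, Matrix.mul_one, sub_eq_zero] at this
  have h2 : U * (Ad * A) = U := by
    have := mul_eq_zero_of_ker_le h.ge (B := Ad * A - 1)
      (by rw [Matrix.mul_sub, ← Matrix.mul_assoc, hA1, Matrix.mul_one, sub_self])
    rwa [Matrix.mul_sub, Matrix.mul_one, sub_eq_zero] at this
  calc Ud * U = (Ud * U * (Ad * A))ᵀ := by rw [Matrix.mul_assoc, h2, hU4]
    _ = Ad * A * (Ud * U) := by rw [Matrix.transpose_mul, hA4, hU4]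
    _ = Ad * A := by rw [Matrix.mul_assoc, h1]

/-- The projection `A * G` fixes every matrix whose range lies in that of `A`. -/
theorem IsMoorePenrose.right_proj_mul {m n p : ℕ} {A : Matrix (Fin m) (Fin n) ℝ}
    {U : Matrix (Fin m) (Fin p) ℝ} {Ad : Matrix (Fin n) (Fin m) ℝ} (hA : IsMoorePenrose A Ad)
    (h : LinearMap.range U.mulVecLin ≤ LinearMap.range A.mulVecLin) : A * Ad * U = U := by
  refine Matrix.ext_of_mulVec_single fun i => ?_
  obtain ⟨y, hy⟩ := h ⟨Pi.single i 1, rfl⟩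
  simp only [Matrix.mulVecLin_apply] at hy
  rw [← Matrix.mulVec_mulVec, ← hy, Matrix.mulVec_mulVec, hA.1]

/-- The projections `A * G` attached to Moore-Penrose inverses depend only on the range. -/
theorem IsMoorePenrose.right_proj_eq {m n : ℕ} {A U : Matrix (Fin m) (Fin n) ℝ}
    {Ad Ud : Matrix (Fin n) (Fin m) ℝ} (hA : IsMoorePenrose A Ad) (hU : IsMoorePenrose U Ud)
    (h : LinearMap.range U.mulVecLin = LinearMap.range A.mulVecLin) : U * Ud = A * Ad := by
  have h1 := hA.right_proj_mul h.le
  have h2 := hU.right_proj_mul h.ge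
  calc U * Ud = (A * Ad * (U * Ud))ᵀ := by rw [← Matrix.mul_assoc, h1, hU.2.2.1]
    _ = U * Ud * (A * Ad) := by rw [Matrix.transpose_mul, hA.2.2.1, hU.2.2.1]
    _ = A * Ad := by rw [← Matrix.mul_assoc, h2]

/-- The fixed-point equation for the Moore-Penrose inverse given by a proper splitting. -/
theorem IsProperSplitting.moorePenrose_eq {m n : ℕ} {A U V : Matrix (Fin m) (Fin n) ℝ}
    {Ad Ud : Matrix (Fin n) (Fin m) ℝ} (hA : IsMoorePenrose A Ad) (hU : IsMoorePenrose U Ud)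
    (h : IsProperSplitting A U V) : Ad = Ud + Ud * V * Ad := by
  obtain ⟨hAUV, hr, hk⟩ := h
  have hV : V = U - A := by rw [hAUV]; abel
  have h1 : Ud * U * Ad = Ad := by rw [hA.left_proj_eq hU hk, hA.2.1]
  have h2 : Ud * A * Ad = Ud := by
    rw [Matrix.mul_assoc, ← hA.right_proj_eq hU hr, ← Matrix.mul_assoc, hU.2.1]
  rw [hV, Matrix.mul_sub, Matrix.sub_mul, h1, h2]
  abel

/-- Iterating a fixed-point equation `G = B + T * G`. -/
theorem eq_sum_pow_mul_add {m n : ℕ} {T : Matrix (Fin n) (Fin n) ℝ}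
    {G B : Matrix (Fin n) (Fin m) ℝ} (h : G = B + T * G) (N : ℕ) :
    G = ∑ k ∈ Finset.range N, T ^ k * B + T ^ N * G := by
  induction N with
  | zero => simp
  | succ N ih =>
    calc G = ∑ k ∈ Finset.range N, T ^ k * B + T ^ N * (B + T * G) := by rw [← h, ← ih]
      _ = _ := by
        rw [Finset.sum_range_succ, pow_succ, Matrix.mul_add, Matrix.mul_assoc, add_assoc]

theorem matrix_mul_nonneg {l m n : ℕ} {A : Matrix (Fin l) (Fin m) ℝ}
    {B : Matrix (Fin m) (Fin n) ℝ} (hA : ∀ i j, 0 ≤ A i j) (hB : ∀ i j, 0 ≤ B i j) (i : Fin l)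
    (j : Fin n) : 0 ≤ (A * B) i j := by
  rw [Matrix.mul_apply]
  exact Finset.sum_nonneg fun k _ => mul_nonneg (hA i k) (hB k j)

theorem matrix_pow_nonneg {n : ℕ} {T : Matrix (Fin n) (Fin n) ℝ} (hT : ∀ i j, 0 ≤ T i j)
    (k : ℕ) : ∀ i j, 0 ≤ (T ^ k) i j := by
  induction k with
  | zero => intro i j; rw [pow_zero, Matrix.one_apply]; split_ifs <;> norm_num
  | succ k ih => rw [pow_succ]; exact matrix_mul_nonneg ih hT

theorem tendsto_matrix_mul_zero {l m n : ℕ} {X : ℕ → Matrix (Fin l) (Fin m) ℝ}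
    (hX : ∀ i j, Tendsto (fun k => X k i j) atTop (𝓝 0)) (B : Matrix (Fin m) (Fin n) ℝ)
    (i : Fin l) (j : Fin n) : Tendsto (fun k => (X k * B) i j) atTop (𝓝 0) := by
  simp only [Matrix.mul_apply]
  simpa using tendsto_finsetSum Finset.univ fun p _ => (hX i p).mul_const (B p j)

theorem stmt4 {m n : ℕ} (A U V : Matrix (Fin m) (Fin n) ℝ)
    (Ad Ud : Matrix (Fin n) (Fin m) ℝ)
    (hA : IsMoorePenrose A Ad) (hU : IsMoorePenrose U Ud)
    (hPS : IsProperSplitting A U V)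
    (hUd : ∀ i j, 0 ≤ Ud i j) (hUV : ∀ i j, 0 ≤ (Ud * V) i j) :
    (∀ i j, 0 ≤ Ad i j) ↔ specRad (Ud * V) < 1 := by
  have hfix := hPS.moorePenrose_eq hA hU
  have hnn (k : ℕ) := matrix_mul_nonneg (matrix_pow_nonneg hUV k) hUd
  have hsum (N : ℕ) (i : Fin n) (j : Fin m) :
      Ad i j = ∑ k ∈ Finset.range N, ((Ud * V) ^ k * Ud) i j + ((Ud * V) ^ N * Ad) i j := by
    conv_lhs => rw [eq_sum_pow_mul_add hfix N]
    rw [Matrix.add_apply, Matrix.sum_apply]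
  rw [specRad_lt_one_iff_tendsto_pow]
  constructor
  · intro hAd i j
    have hz (i : Fin n) (j : Fin m) :
        Tendsto (fun k : ℕ => ((Ud * V) ^ k * Ud) i j) atTop (𝓝 0) := by
      refine (summable_of_sum_range_le (c := Ad i j) (fun k => hnn k i j) fun N => ?_)
        |>.tendsto_atTop_zero
      have := matrix_mul_nonneg (matrix_pow_nonneg hUV N) hAd i j
      linarith [hsum N i j]
    refine (tendsto_add_atTop_iff_nat 1).1 ?_
    simpa only [pow_succ, Matrix.mul_assoc] using tendsto_matrix_mul_zero hz V i j
  · intro hT i j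
    have hlim : Tendsto (fun N : ℕ => Ad i j - ((Ud * V) ^ N * Ad) i j) atTop (𝓝 (Ad i j)) := by
      simpa using (tendsto_matrix_mul_zero hT Ad i j).const_sub (Ad i j)
    refine ge_of_tendsto' hlim fun N => ?_
    rw [hsum N i j, add_sub_cancel_right]
    exact Finset.sum_nonneg fun k _ => hnn k i j
end

section
/- Let A = U − V be a proper splitting of a real m×n matrix A with U†V ≥ 0 (a proper nonnegative splitting), and suppose A†U ≥ 0. Then ρ(U†V) = (ρ(A†U) − 1)/ρ(A†U) < 1. -/
open Matrix

/-- Every complex eigenvalue has modulus at most the spectral radius. -/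
theorem norm_le_specRad {k : ℕ} (X : Matrix (Fin k) (Fin k) ℝ) {l : ℂ} {z : Fin k → ℂ}
    (hz : z ≠ 0) (h : X.map Complex.ofReal *ᵥ z = l • z) : ‖l‖ ≤ specRad X := by
  let := Matrix.linftyOpNormedRing (n := Fin k) (α := ℂ)
  let := Matrix.linftyOpNormedAlgebra (n := Fin k) (R := ℂ) (α := ℂ)
  have : CompleteSpace (Matrix (Fin k) (Fin k) ℂ) := FiniteDimensional.complete ℂ _
  have hmem : l ∈ spectrum ℂ (X.map Complex.ofReal) := by
    rw [← Matrix.spectrum_toLin', ← Module.End.hasEigenvalue_iff_mem_spectrum]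
    exact Module.End.hasEigenvalue_of_hasEigenvector
      ⟨Module.End.mem_eigenspace_iff.mpr (by simpa using h), hz⟩
  have hle : (‖l‖₊ : ENNReal) ≤ spectralRadius ℂ (X.map Complex.ofReal) :=
    le_iSup₂ (f := fun (a : ℂ) (_ : a ∈ spectrum ℂ (X.map Complex.ofReal)) =>
      (‖a‖₊ : ENNReal)) l hmem
  have hfin : spectralRadius ℂ (X.map Complex.ofReal) ≠ ⊤ := by
    have : Nonempty (Fin k) := by
      by_contra hne
      rw [not_nonempty_iff] at hne
      exact hz (Subsingleton.elim _ _)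
    exact ((spectrum.spectralRadius_le_nnnorm (𝕜 := ℂ) (X.map Complex.ofReal)).trans_lt
      ENNReal.coe_lt_top).ne
  simpa [specRad] using ENNReal.toReal_mono hfin hle

/-- The spectral radius is attained by a complex eigenvalue. -/
theorem exists_eigenvector_norm_eq_specRad {k : ℕ} (hk : 0 < k)
    (X : Matrix (Fin k) (Fin k) ℝ) :
    ∃ (l : ℂ) (z : Fin k → ℂ), z ≠ 0 ∧ X.map Complex.ofReal *ᵥ z = l • z ∧
      ‖l‖ = specRad X := by
  let := Matrix.linftyOpNormedRing (n := Fin k) (α := ℂ)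
  let := Matrix.linftyOpNormedAlgebra (n := Fin k) (R := ℂ) (α := ℂ)
  have : CompleteSpace (Matrix (Fin k) (Fin k) ℂ) := FiniteDimensional.complete ℂ _
  have : Nonempty (Fin k) := ⟨⟨0, hk⟩⟩
  obtain ⟨l, hl, hr⟩ := spectrum.exists_nnnorm_eq_spectralRadius (X.map Complex.ofReal)
  rw [← Matrix.spectrum_toLin', ← Module.End.hasEigenvalue_iff_mem_spectrum] at hl
  obtain ⟨z, hz⟩ := hl.exists_hasEigenvector
  refine ⟨l, z, hz.2, by simpa using hz.apply_eq_smul, ?_⟩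
  rw [specRad, ← hr]
  simp

theorem mulVec_mono_of_nonneg {k : ℕ} {X : Matrix (Fin k) (Fin k) ℝ}
    (hX : ∀ i j, 0 ≤ X i j) {u v : Fin k → ℝ} (h : u ≤ v) : X *ᵥ u ≤ X *ᵥ v :=
  fun i => dotProduct_le_dotProduct_of_nonneg_left h (hX i)

theorem map_ofReal_mulVec {k : ℕ} (X : Matrix (Fin k) (Fin k) ℝ) (u : Fin k → ℝ) :
    X.map Complex.ofReal *ᵥ (fun i => (u i : ℂ)) = fun i => ((X *ᵥ u) i : ℂ) := by
  ext i
  simp [Matrix.mulVec, dotProduct]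

/-- Collatz–Wielandt lower bound for the spectral radius of a nonnegative matrix. -/
theorem le_specRad_of_smul_le_mulVec {k : ℕ} {X : Matrix (Fin k) (Fin k) ℝ}
    (hX : ∀ i j, 0 ≤ X i j) {u : Fin k → ℝ} (hu : 0 ≤ u) (hu0 : u ≠ 0) {c : ℝ}
    (hc : 0 ≤ c) (h : c • u ≤ X *ᵥ u) : c ≤ specRad X := by
  let := Matrix.linftyOpNormedRing (n := Fin k) (α := ℂ)
  let := Matrix.linftyOpNormedAlgebra (n := Fin k) (R := ℂ) (α := ℂ)
  have : CompleteSpace (Matrix (Fin k) (Fin k) ℂ) := FiniteDimensional.complete ℂ _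
  have : Nonempty (Fin k) := by
    by_contra hne
    rw [not_nonempty_iff] at hne
    exact hu0 (Subsingleton.elim _ _)
  have hpow : ∀ p : ℕ, c ^ p • u ≤ (X ^ p) *ᵥ u := by
    intro p
    induction p with
    | zero => simp
    | succ p ih =>
      calc c ^ (p + 1) • u = c ^ p • (c • u) := by rw [smul_smul, pow_succ]
        _ ≤ c ^ p • (X *ᵥ u) := smul_le_smul_of_nonneg_left h (pow_nonneg hc p)
        _ = X *ᵥ (c ^ p • u) := (Matrix.mulVec_smul _ _ _).symm
        _ ≤ X *ᵥ ((X ^ p) *ᵥ u) := mulVec_mono_of_nonneg hX ih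
        _ = (X ^ (p + 1)) *ᵥ u := by rw [Matrix.mulVec_mulVec, pow_succ']
  have hnorm : ∀ p : ℕ, c ^ p ≤ ‖(X.map Complex.ofReal) ^ p‖ := by
    intro p
    have hmap : (X.map Complex.ofReal) ^ p = (X ^ p).map Complex.ofReal :=
      (map_pow (Complex.ofRealHom.mapMatrix (m := Fin k)) X p).symm
    have hun : 0 < ‖u‖ := norm_pos_iff.mpr hu0
    refine le_of_mul_le_mul_right ?_ hun
    have hcu : c ^ p * ‖u‖ = ‖c ^ p • u‖ := by
      rw [norm_smul, Real.norm_of_nonneg (pow_nonneg hc p)]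
    have hle : ‖c ^ p • u‖ ≤ ‖(X ^ p) *ᵥ u‖ := by
      refine (pi_norm_le_iff_of_nonneg (norm_nonneg _)).mpr fun i => ?_
      refine le_trans ?_ (norm_le_pi_norm _ i)
      have h0 : 0 ≤ (c ^ p • u) i := mul_nonneg (pow_nonneg hc p) (hu i)
      rw [Real.norm_of_nonneg h0, Real.norm_of_nonneg (h0.trans (hpow p i))]
      exact hpow p i
    have hcomplex : ∀ v : Fin k → ℝ, ‖(fun i => (v i : ℂ))‖ = ‖v‖ := by
      intro v
      simp [Pi.norm_def]
    calc c ^ p * ‖u‖ ≤ ‖(X ^ p) *ᵥ u‖ := hcu ▸ hle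
      _ = ‖(X.map Complex.ofReal) ^ p *ᵥ (fun i => (u i : ℂ))‖ := by
        rw [hmap, map_ofReal_mulVec, hcomplex]
      _ ≤ ‖(X.map Complex.ofReal) ^ p‖ * ‖(fun i => (u i : ℂ))‖ :=
        Matrix.linfty_opNorm_mulVec _ _
      _ = _ := by rw [hcomplex]
  have hlim := spectrum.pow_norm_pow_one_div_tendsto_nhds_spectralRadius (X.map Complex.ofReal)
  have hge : ENNReal.ofReal c ≤ spectralRadius ℂ (X.map Complex.ofReal) := by
    refine ge_of_tendsto hlim ?_
    filter_upwards [Filter.eventually_ge_atTop 1] with p hp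
    refine ENNReal.ofReal_le_ofReal ?_
    have hp0 : (p : ℝ) ≠ 0 := by positivity
    calc c = (c ^ p) ^ (1 / (p : ℝ)) := by
          rw [← Real.rpow_natCast, ← Real.rpow_mul hc, mul_one_div_cancel hp0, Real.rpow_one]
      _ ≤ _ := Real.rpow_le_rpow (pow_nonneg hc p) (hnorm p) (by positivity)
  have hfin : spectralRadius ℂ (X.map Complex.ofReal) ≠ ⊤ :=
    ((spectrum.spectralRadius_le_nnnorm (𝕜 := ℂ) (X.map Complex.ofReal)).trans_lt
      ENNReal.coe_lt_top).ne
  exact (ENNReal.ofReal_le_iff_le_toReal hfin).mp hge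

/-- A nonnegative matrix with positive spectral radius `r` has a nonnegative nonzero vector `u`
in its range with `r • u ≤ T *ᵥ u`. -/
theorem exists_nonneg_specRad_smul_le_mulVec {k : ℕ} {T : Matrix (Fin k) (Fin k) ℝ}
    (hT : ∀ i j, 0 ≤ T i j) (hr : 0 < specRad T) :
    ∃ w : Fin k → ℝ, 0 ≤ T *ᵥ w ∧ T *ᵥ w ≠ 0 ∧ specRad T • (T *ᵥ w) ≤ T *ᵥ (T *ᵥ w) := by
  have hk : 0 < k := by
    rcases Nat.eq_zero_or_pos k with rfl | hk
    · simp [specRad] at hr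
    · exact hk
  obtain ⟨l, z, hz, hlz, hl⟩ := exists_eigenvector_norm_eq_specRad hk T
  set w : Fin k → ℝ := fun i => ‖z i‖ with hw
  have hw0 : 0 ≤ w := fun i => norm_nonneg _
  have hwT : specRad T • w ≤ T *ᵥ w := by
    intro i
    calc (specRad T • w) i = ‖(l • z) i‖ := by simp [hw, hl]
      _ = ‖∑ j, (T i j : ℂ) * z j‖ := by rw [← hlz]; rfl
      _ ≤ ∑ j, ‖(T i j : ℂ) * z j‖ := norm_sum_le _ _
      _ = (T *ᵥ w) i := Finset.sum_congr rfl fun j _ => by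
        rw [norm_mul, Complex.norm_real, Real.norm_of_nonneg (hT i j)]
  have hrw : 0 ≤ specRad T • w := smul_nonneg hr.le hw0
  refine ⟨w, hrw.trans hwT, fun h => hz ?_, ?_⟩
  · have h0 : specRad T • w = 0 := le_antisymm (h ▸ hwT) hrw
    ext i
    have hi := congrFun ((smul_eq_zero.mp h0).resolve_left hr.ne') i
    simpa [hw] using hi
  · rw [← Matrix.mulVec_smul]
    exact mulVec_mono_of_nonneg hT hwT

/-- If `M` inverts `P - T` relative to a projection `P`, then the spectral radii of the
nonnegative matrices `T` and `M` are related as those of `T` and `(1 - T)⁻¹`. -/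
theorem specRad_eq_of_relative_inverse {k : ℕ} {P T M : Matrix (Fin k) (Fin k) ℝ}
    (hT : ∀ i j, 0 ≤ T i j) (hM : ∀ i j, 0 ≤ M i j) (hPP : P * P = P) (hPT : P * T = T)
    (hPM : P * M = M) (hMT : M * T = M - P) (hTM : T * M = M - P) :
    specRad T = (specRad M - 1) / specRad M ∧ specRad T < 1 := by
  have hspec0 : specRad (0 : Matrix (Fin k) (Fin k) ℝ) = 0 := by
    rcases Nat.eq_zero_or_pos k with rfl | hk
    · simp [specRad]
    · obtain ⟨l, z, hz, hlz, hl⟩ :=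
        exists_eigenvector_norm_eq_specRad hk (0 : Matrix (Fin k) (Fin k) ℝ)
      have h0 : l • z = 0 := by rw [← hlz]; ext i; simp [Matrix.mulVec, dotProduct]
      rw [← hl, (smul_eq_zero.mp h0).resolve_right hz, norm_zero]
  by_cases hP : P = 0
  · have hT0 : T = 0 := by rw [← hPT, hP, zero_mul]
    have hM0 : M = 0 := by rw [← hPM, hP, zero_mul]
    simp [hT0, hM0, hspec0]
  have hk : 0 < k := by
    rcases Nat.eq_zero_or_pos k with rfl | hk
    · exact absurd (Subsingleton.elim _ _) hP
    · exact hk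
  have hcomp : ∀ {X Y Z : Matrix (Fin k) (Fin k) ℝ}, X * Y = Z →
      X.map Complex.ofReal * Y.map Complex.ofReal = Z.map Complex.ofReal := by
    rintro X Y _ rfl
    exact (map_mul (Complex.ofRealHom.mapMatrix (m := Fin k)) X Y).symm
  have hsub : (M - P).map Complex.ofReal = M.map Complex.ofReal - P.map Complex.ofReal :=
    map_sub (Complex.ofRealHom.mapMatrix (m := Fin k)) M P
  have hr0 : 0 ≤ specRad T := ENNReal.toReal_nonneg
  have hlower : specRad T < 1 ∧ 1 / (1 - specRad T) ≤ specRad M := by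
    rcases hr0.lt_or_eq with hr | hr
    · obtain ⟨w, hu, hu0, hru⟩ := exists_nonneg_specRad_smul_le_mulVec hT hr
      set u := T *ᵥ w with hu_def
      have hPu : P *ᵥ u = u := by rw [hu_def, Matrix.mulVec_mulVec, hPT]
      have hMu0 : 0 ≤ M *ᵥ u := by
        simpa using mulVec_mono_of_nonneg hM hu
      have hMTu : M *ᵥ (T *ᵥ u) = M *ᵥ u - u := by
        rw [Matrix.mulVec_mulVec, hMT, Matrix.sub_mulVec, hPu]
      have hkey : u ≤ (1 - specRad T) • (M *ᵥ u) := by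
        have h1 := mulVec_mono_of_nonneg hM hru
        rw [Matrix.mulVec_smul, hMTu] at h1
        intro i
        have := h1 i
        simp only [Pi.smul_apply, Pi.sub_apply, smul_eq_mul] at this ⊢
        linarith
      have hlt : specRad T < 1 := by
        by_contra! hge
        refine hu0 (le_antisymm (fun i => (hkey i).trans ?_) hu)
        exact mul_nonpos_of_nonpos_of_nonneg (by linarith) (hMu0 i)
      have hpos : 0 < 1 - specRad T := by linarith
      refine ⟨hlt, le_specRad_of_smul_le_mulVec hM hu hu0 (by positivity) fun i => ?_⟩
      have := hkey i
      simp only [Pi.smul_apply, smul_eq_mul] at this ⊢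
      rw [one_div, inv_mul_le_iff₀ hpos]
      exact this
    · rw [← hr]
      refine ⟨one_pos, ?_⟩
      let W := LinearMap.range (P.map Complex.ofReal).mulVecLin
      let f := (T.map Complex.ofReal).mulVecLin
      have hf : ∀ x ∈ W, f x ∈ W := fun x _ =>
        ⟨f x, by simp [f, Matrix.mulVec_mulVec, hcomp hPT]⟩
      have : Nontrivial W := by
        rw [Submodule.nontrivial_iff_ne_bot, Ne, LinearMap.range_eq_bot]
        intro h
        apply hP
        ext i j
        have := congrFun (LinearMap.congr_fun h (Pi.single j 1)) i
        simpa using this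
      obtain ⟨a, ha⟩ := Module.End.exists_eigenvalue (f.restrict hf)
      obtain ⟨⟨x, y, hy⟩, hx, hx0⟩ := ha.exists_hasEigenvector
      have hTx : T.map Complex.ofReal *ᵥ x = a • x :=
        congrArg Subtype.val (Module.End.mem_eigenspace_iff.mp hx)
      have hxne : x ≠ 0 := fun h => hx0 (Subtype.ext h)
      have ha0 : a = 0 := by
        rw [← norm_le_zero_iff, hr]
        exact norm_le_specRad T hxne hTx
      have hPx : P.map Complex.ofReal *ᵥ x = x := by
        rw [← hy, Matrix.mulVecLin_apply, Matrix.mulVec_mulVec, hcomp hPP]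
      have hMx : M.map Complex.ofReal *ᵥ x = (1 : ℂ) • x := by
        have h1 : (M.map Complex.ofReal * T.map Complex.ofReal) *ᵥ x = 0 := by
          rw [← Matrix.mulVec_mulVec, hTx, ha0, zero_smul, Matrix.mulVec_zero]
        rw [hcomp hMT, hsub, Matrix.sub_mulVec, hPx, sub_eq_zero] at h1
        rw [h1, one_smul]
      simpa using norm_le_specRad M hxne hMx
  obtain ⟨hlt, hle⟩ := hlower
  have hpos : 0 < 1 - specRad T := by linarith
  have hs : 0 < specRad M := lt_of_lt_of_le (by positivity) hle
  obtain ⟨b, x, hx, hMx, hb⟩ := exists_eigenvector_norm_eq_specRad hk M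
  have hb0 : b ≠ 0 := norm_pos_iff.mp (hb ▸ hs)
  have hPx : P.map Complex.ofReal *ᵥ x = x := by
    have h1 : P.map Complex.ofReal *ᵥ (b • x) = b • x := by
      rw [← hMx, Matrix.mulVec_mulVec, hcomp hPM]
    rw [Matrix.mulVec_smul] at h1
    exact smul_right_injective _ hb0 h1
  have hTx : T.map Complex.ofReal *ᵥ x = (1 - b⁻¹) • x := by
    have h1 : T.map Complex.ofReal *ᵥ (b • x) = b • x - x := by
      rw [← hMx, Matrix.mulVec_mulVec, hcomp hTM, hsub, Matrix.sub_mulVec, hPx]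
    rw [Matrix.mulVec_smul] at h1
    apply smul_right_injective _ hb0
    simp only
    rw [h1, smul_smul, mul_sub, mul_inv_cancel₀ hb0, sub_smul, mul_one, one_smul]
  have hupper : 1 - specRad T ≤ (specRad M)⁻¹ := by
    have h1 := norm_le_specRad T hx hTx
    have h2 := norm_sub_norm_le (1 : ℂ) (1 - b⁻¹)
    rw [sub_sub_cancel, norm_inv, hb, norm_one] at h2
    linarith
  refine ⟨?_, hlt⟩
  have h3 : (specRad M)⁻¹ ≤ 1 - specRad T := by
    rw [inv_le_comm₀ hs hpos, ← one_div]
    exact hle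
  rw [sub_div, div_self hs.ne', one_div]
  linarith

theorem mul_eq_self_of_range_le {m n : ℕ} {A U : Matrix (Fin m) (Fin n) ℝ}
    {G : Matrix (Fin n) (Fin m) ℝ} (hG : A * G * A = A)
    (h : LinearMap.range U.mulVecLin ≤ LinearMap.range A.mulVecLin) : A * G * U = U := by
  refine Matrix.ext_of_mulVec_single fun j => ?_
  obtain ⟨y, hy⟩ := h ⟨Pi.single j 1, rfl⟩
  simp only [Matrix.mulVecLin_apply] at hy
  rw [← Matrix.mulVec_mulVec, ← hy, Matrix.mulVec_mulVec, hG]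

theorem mul_eq_self_of_ker_le {m n : ℕ} {A U : Matrix (Fin m) (Fin n) ℝ}
    {G : Matrix (Fin n) (Fin m) ℝ} (hG : A * G * A = A)
    (h : LinearMap.ker A.mulVecLin ≤ LinearMap.ker U.mulVecLin) : U * (G * A) = U := by
  refine Matrix.ext_of_mulVec_single fun j => ?_
  have hmem : (G * A) *ᵥ Pi.single j 1 - Pi.single j 1 ∈ LinearMap.ker A.mulVecLin := by
    rw [LinearMap.mem_ker, Matrix.mulVecLin_apply, Matrix.mulVec_sub, Matrix.mulVec_mulVec,
      ← Matrix.mul_assoc, hG, sub_self]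
  have h1 := h hmem
  rw [LinearMap.mem_ker, Matrix.mulVecLin_apply, Matrix.mulVec_sub, Matrix.mulVec_mulVec,
    sub_eq_zero] at h1
  exact h1

theorem stmt6 {m n : ℕ} (A U V : Matrix (Fin m) (Fin n) ℝ)
    (Ad Ud : Matrix (Fin n) (Fin m) ℝ)
    (hA : IsMoorePenrose A Ad) (hU : IsMoorePenrose U Ud)
    (hPS : IsProperSplitting A U V)
    (hUV : ∀ i j, 0 ≤ (Ud * V) i j)
    (hAU : ∀ i j, 0 ≤ (Ad * U) i j) :
    specRad (Ud * V) = (specRad (Ad * U) - 1) / specRad (Ad * U) ∧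
      specRad (Ud * V) < 1 := by
  obtain ⟨hA1, hA2, -, hA4⟩ := hA
  obtain ⟨hU1, hU2, -, hU4⟩ := hU
  obtain ⟨hAUV, hrange, hker⟩ := hPS
  have hV : V = U - A := by rw [hAUV, sub_sub_cancel]
  have hAAU : A * Ad * U = U := mul_eq_self_of_range_le hA1 hrange.le
  have hUUA : U * Ud * A = A := mul_eq_self_of_range_le hU1 hrange.ge
  have hUP : U * (Ad * A) = U := mul_eq_self_of_ker_le hA1 hker.ge
  have hAP : A * (Ud * U) = A := mul_eq_self_of_ker_le hU1 hker.le
  have hproj : Ud * U = Ad * A := by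
    have h1 : Ud * U * (Ad * A) = Ud * U := by rw [Matrix.mul_assoc, hUP]
    have h2 : Ad * A * (Ud * U) = Ad * A := by rw [Matrix.mul_assoc, hAP]
    have h3 := congrArg Matrix.transpose h1
    rw [Matrix.transpose_mul, hA4, hU4, h2] at h3
    exact h3.symm
  refine specRad_eq_of_relative_inverse (P := Ud * U) hUV hAU ?_ ?_ ?_ ?_ ?_
  · rw [← Matrix.mul_assoc, hU2]
  · rw [← Matrix.mul_assoc, hU2]
  · rw [hproj, ← Matrix.mul_assoc, hA2]
  · rw [hV, Matrix.mul_sub, Matrix.mul_sub, Matrix.mul_assoc Ad U (Ud * U),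
      Matrix.mul_assoc Ad U (Ud * A), ← Matrix.mul_assoc U Ud U, ← Matrix.mul_assoc U Ud A,
      hU1, hUUA, hproj]
  · rw [hV, Matrix.mul_sub, Matrix.sub_mul, hproj, ← Matrix.mul_assoc, hA2,
      Matrix.mul_assoc Ud A, ← Matrix.mul_assoc A, hAAU, hproj]
end

section
/- Let A be a real m×n semi-monotone matrix (A† ≥ 0). Let A = B − C be a proper weak regular splitting and A = U − V be a proper regular splitting of A. If B† ≥ U† (entrywise) and every row sum of U† is positive, then ρ(B†C) ≤ ρ(U†V) < 1. -/
open Matrix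

lemma mulVec_apply_nonneg {m n : ℕ} {M : Matrix (Fin m) (Fin n) ℝ} (hM : ∀ i j, 0 ≤ M i j)
    {w : Fin n → ℝ} (hw : ∀ j, 0 ≤ w j) (i : Fin m) : 0 ≤ (M *ᵥ w) i := by
  rw [Matrix.mulVec_eq_sum, Finset.sum_apply]
  exact Finset.sum_nonneg fun j _ => mul_nonneg (hM i j) (hw j)

/-- Moore-Penrose inverses of matrices with equal null spaces have the same row-space projection. -/
lemma IsMoorePenrose.mul_mul_of_ker_eq {m n : ℕ} {X Y : Matrix (Fin m) (Fin n) ℝ}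
    {Xd Yd : Matrix (Fin n) (Fin m) ℝ} (hX : IsMoorePenrose X Xd) (hY : IsMoorePenrose Y Yd)
    (h : LinearMap.ker X.mulVecLin = LinearMap.ker Y.mulVecLin) : Xd * X * Yd = Yd := by
  obtain ⟨hX1, -, -, hX4⟩ := hX
  obtain ⟨-, hY2, -, hY4⟩ := hY
  have hYX : Y * (Xd * X) = Y := by
    refine Matrix.ext_of_mulVec_single fun i => ?_
    have hk : (Xd * X) *ᵥ Pi.single i 1 - Pi.single i 1 ∈ LinearMap.ker X.mulVecLin := by
      rw [LinearMap.mem_ker, Matrix.mulVecLin_apply, Matrix.mulVec_sub, Matrix.mulVec_mulVec,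
        ← Matrix.mul_assoc, hX1, sub_self]
    rw [h, LinearMap.mem_ker, Matrix.mulVecLin_apply, Matrix.mulVec_sub, Matrix.mulVec_mulVec,
      sub_eq_zero] at hk
    exact hk
  have hP : Yd * Y * (Xd * X) = Yd * Y := by rw [Matrix.mul_assoc, hYX]
  have hP' := congrArg Matrix.transpose hP
  rw [Matrix.transpose_mul, hX4, hY4] at hP'
  calc Xd * X * Yd = Xd * X * (Yd * Y) * Yd := by rw [Matrix.mul_assoc (Xd * X), hY2]
    _ = Yd := by rw [hP', hY2]

/-- Moore-Penrose inverses of matrices with equal ranges have the same range projection. -/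
lemma IsMoorePenrose.mul_mul_of_range_eq {m n : ℕ} {X Y : Matrix (Fin m) (Fin n) ℝ}
    {Xd Yd : Matrix (Fin n) (Fin m) ℝ} (hX : IsMoorePenrose X Xd) (hY : IsMoorePenrose Y Yd)
    (h : LinearMap.range X.mulVecLin = LinearMap.range Y.mulVecLin) : Xd * (Y * Yd) = Xd := by
  obtain ⟨-, hX2, hX3, -⟩ := hX
  obtain ⟨hY1, -, hY3, -⟩ := hY
  have hYX : Y * Yd * X = X := by
    refine Matrix.ext_of_mulVec_single fun i => ?_
    have hr : X *ᵥ Pi.single i 1 ∈ LinearMap.range X.mulVecLin := ⟨_, rfl⟩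
    rw [h] at hr
    obtain ⟨w, hw⟩ := hr
    rw [Matrix.mulVecLin_apply] at hw
    rw [← Matrix.mulVec_mulVec, ← hw, Matrix.mulVec_mulVec, hY1]
  have hP : Y * Yd * (X * Xd) = X * Xd := by rw [← Matrix.mul_assoc, hYX]
  have hP' := congrArg Matrix.transpose hP
  rw [Matrix.transpose_mul, hX3, hY3] at hP'
  calc Xd * (Y * Yd) = Xd * (X * Xd * (Y * Yd)) := by
        rw [← Matrix.mul_assoc Xd (X * Xd), ← Matrix.mul_assoc Xd X, hX2]
    _ = Xd := by rw [hP', ← Matrix.mul_assoc, hX2]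

/-- Collatz-Wielandt upper bound for the spectral radius of a nonnegative matrix. -/
lemma specRad_le_of_mulVec_le {k : ℕ} {T : Matrix (Fin k) (Fin k) ℝ} (hT : ∀ i j, 0 ≤ T i j)
    {x : Fin k → ℝ} (hx : ∀ i, 0 < x i) {θ : ℝ} (hθ : 0 ≤ θ)
    (h : ∀ i, (T *ᵥ x) i ≤ θ * x i) : specRad T ≤ θ := by
  refine ENNReal.toReal_le_of_le_ofReal hθ (iSup₂_le fun z hz => ?_)
  rw [← enorm_eq_nnnorm, ← ofReal_norm]
  refine ENNReal.ofReal_le_ofReal ?_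
  rw [← Matrix.spectrum_toLin', ← Module.End.hasEigenvalue_iff_mem_spectrum] at hz
  obtain ⟨v, hv⟩ := hz.exists_hasEigenvector
  have hTv := hv.apply_eq_smul
  rw [Matrix.toLin'_apply] at hTv
  obtain ⟨i₀, hi₀⟩ := Function.ne_iff.mp hv.2
  obtain ⟨i, -, hi⟩ := Finset.exists_max_image Finset.univ (fun i => ‖v i‖ / x i)
    ⟨i₀, Finset.mem_univ _⟩
  have hci : 0 < ‖v i‖ / x i :=
    (div_pos (norm_pos_iff.mpr hi₀) (hx i₀)).trans_le (hi i₀ (Finset.mem_univ _))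
  have hvi : 0 < ‖v i‖ := by
    simpa [div_mul_cancel₀ _ (hx i).ne'] using mul_pos hci (hx i)
  refine le_of_mul_le_mul_right ?_ hvi
  calc ‖z‖ * ‖v i‖ = ‖∑ j, (T i j : ℂ) * v j‖ := by
        rw [← norm_mul]
        exact congrArg norm (congrFun hTv i).symm
    _ ≤ ∑ j, ‖(T i j : ℂ) * v j‖ := norm_sum_le _ _
    _ ≤ ∑ j, ‖v i‖ / x i * (T i j * x j) := by
        refine Finset.sum_le_sum fun j _ => ?_
        rw [norm_mul, Complex.norm_real, Real.norm_of_nonneg (hT i j), mul_left_comm]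
        exact mul_le_mul_of_nonneg_left
          ((div_le_iff₀ (hx j)).mp (hi j (Finset.mem_univ _))) (hT i j)
    _ = ‖v i‖ / x i * (T *ᵥ x) i := by rw [← Finset.mul_sum]; rfl
    _ ≤ ‖v i‖ / x i * (θ * x i) := mul_le_mul_of_nonneg_left (h i) hci.le
    _ = θ * ‖v i‖ := by rw [mul_left_comm, div_mul_cancel₀ _ (hx i).ne']

section
attribute [local instance] Matrix.linftyOpNormedRing Matrix.linftyOpNormedAlgebra

/-- Scaled powers of a matrix tend to zero if the scale exceeds the spectral radius. -/
lemma tendsto_inv_pow_smul_pow_of_specRad_lt {k : ℕ} {T : Matrix (Fin k) (Fin k) ℝ} {μ : ℝ}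
    (h : specRad T < μ) :
    Filter.Tendsto (fun N : ℕ => (μ⁻¹) ^ N • T ^ N) Filter.atTop (nhds 0) := by
  obtain ⟨r, hr, hrμ⟩ := exists_between h
  have hr0 : 0 < r := ENNReal.toReal_nonneg.trans_lt hr
  have hμ : 0 < μ := hr0.trans hrμ
  set S : Matrix (Fin k) (Fin k) ℂ := T.map Complex.ofReal with hS
  have htop : spectralRadius ℂ S ≠ ⊤ := by
    refine ne_top_of_le_ne_top ?_ (spectrum.spectralRadius_le_pow_nnnorm_pow_one_div ℂ S 0)
    finiteness
  have hlt : spectralRadius ℂ S < ENNReal.ofReal r := by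
    rwa [← ENNReal.ofReal_toReal htop, ENNReal.ofReal_lt_ofReal_iff hr0]
  have hev := (spectrum.pow_norm_pow_one_div_tendsto_nhds_spectralRadius S).eventually_lt_const hlt
  have hbound : ∀ᶠ N : ℕ in Filter.atTop, ‖S ^ N‖ ≤ r ^ N := by
    filter_upwards [hev, Filter.eventually_gt_atTop 0] with N hN hN0
    rw [ENNReal.ofReal_lt_ofReal_iff hr0] at hN
    have := pow_le_pow_left₀ (by positivity) hN.le N
    rwa [one_div, Real.rpow_inv_natCast_pow (norm_nonneg _) hN0.ne'] at this
  have hnorm : ∀ N : ℕ, ‖T ^ N‖ = ‖S ^ N‖ := by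
    intro N
    have hpow : S ^ N = (T ^ N).map Complex.ofReal := by
      exact (map_pow Complex.ofRealHom.mapMatrix T N).symm
    rw [hpow]
    simp [Matrix.linfty_opNorm_def]
  refine squeeze_zero_norm' (a := fun N => (μ⁻¹ * r) ^ N) ?_ ?_
  · filter_upwards [hbound] with N hN
    rw [norm_smul, norm_pow, norm_inv, Real.norm_of_nonneg hμ.le, hnorm, mul_pow]
    gcongr
  · refine tendsto_pow_atTop_nhds_zero_of_lt_one (by positivity) ?_
    rw [inv_mul_lt_iff₀ hμ]
    linarith

end

/-- A truncated Neumann series: an approximate solution `x` of `μ x = T x + y`. -/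
lemma exists_neumann_partial {k : ℕ} {T : Matrix (Fin k) (Fin k) ℝ} (hT : ∀ i j, 0 ≤ T i j)
    {y : Fin k → ℝ} (hy : ∀ i, 0 ≤ y i) {μ : ℝ} (hμ : 0 < μ) (N : ℕ) :
    ∃ x : Fin k → ℝ, (∀ i, μ⁻¹ * y i ≤ x i) ∧
      μ • x = T *ᵥ x + y - T *ᵥ (μ⁻¹ • ((μ⁻¹) ^ N • T ^ N) *ᵥ y) := by
  have hpow : ∀ N : ℕ, ∀ i, 0 ≤ (T ^ N *ᵥ y) i := by
    intro N
    induction N with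
    | zero => simpa using hy
    | succ N ih =>
      intro i
      rw [pow_succ', ← Matrix.mulVec_mulVec]
      exact mulVec_apply_nonneg hT ih i
  induction N with
  | zero =>
    refine ⟨μ⁻¹ • y, fun i => le_rfl, ?_⟩
    simp [smul_smul, hμ.ne']
  | succ N ih =>
    obtain ⟨x, hx, hxe⟩ := ih
    refine ⟨x + μ⁻¹ • ((μ⁻¹) ^ (N + 1) • T ^ (N + 1)) *ᵥ y, fun i => ?_, ?_⟩
    · refine (hx i).trans ?_
      simp only [Pi.add_apply, Pi.smul_apply, Matrix.smul_mulVec, smul_eq_mul]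
      have := hpow (N + 1) i
      have : 0 ≤ μ⁻¹ * (μ⁻¹ ^ (N + 1) * (T ^ (N + 1) *ᵥ y) i) := by positivity
      linarith
    · have hz : μ • μ⁻¹ • ((μ⁻¹) ^ (N + 1) • T ^ (N + 1)) *ᵥ y =
          T *ᵥ (μ⁻¹ • ((μ⁻¹) ^ N • T ^ N) *ᵥ y) := by
        rw [smul_inv_smul₀ hμ.ne']
        simp only [Matrix.smul_mulVec, Matrix.mulVec_smul, Matrix.mulVec_mulVec, smul_smul,
          pow_succ' T, pow_succ' μ⁻¹]
      rw [smul_add, hxe, hz, Matrix.mulVec_add]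
      abel

theorem stmt12 {m n : ℕ} (A B C U V : Matrix (Fin m) (Fin n) ℝ)
    (Ad Bd Ud : Matrix (Fin n) (Fin m) ℝ)
    (hA : IsMoorePenrose A Ad) (hB : IsMoorePenrose B Bd) (hU : IsMoorePenrose U Ud)
    (hsemi : ∀ i j, 0 ≤ Ad i j)
    -- A = B - C is a proper weak regular splitting
    (hPSB : IsProperSplitting A B C)
    (hBd : ∀ i j, 0 ≤ Bd i j) (hBC : ∀ i j, 0 ≤ (Bd * C) i j)
    -- A = U - V is a proper regular splitting
    (hPSU : IsProperSplitting A U V)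
    (hUd : ∀ i j, 0 ≤ Ud i j) (hV : ∀ i j, 0 ≤ V i j)
    (hcomp : ∀ i j, Ud i j ≤ Bd i j)
    (hrow : ∀ i, 0 < ∑ j, Ud i j) :
    specRad (Bd * C) ≤ specRad (Ud * V) ∧ specRad (Ud * V) < 1 := by
  obtain ⟨hAU, hUr, hUk⟩ := hPSU
  obtain ⟨hAB, hBr, hBk⟩ := hPSB
  have hT : ∀ i j, 0 ≤ (Ud * V) i j := fun i j => by
    rw [Matrix.mul_apply]
    exact Finset.sum_nonneg fun l _ => mul_nonneg (hUd i l) (hV l j)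
  have hUe : ∀ i, 0 < (Ud *ᵥ 1) i := fun i => by simpa [Matrix.mulVec, dotProduct] using hrow i
  have hlt : specRad (Ud * V) < 1 := by
    set x : Fin n → ℝ := Ad *ᵥ 1 with hxdef
    have hx0 : ∀ i, 0 ≤ x i := fun i =>
      mulVec_apply_nonneg hsemi (fun _ => zero_le_one) i
    have hTx0 : ∀ i, 0 ≤ ((Ud * V) *ᵥ x) i := fun i =>
      mulVec_apply_nonneg hT hx0 i
    have hmat : Ad = Ud + Ud * V * Ad := by
      have hV' : V = U - A := by rw [hAU]; abel
      rw [hV', Matrix.mul_sub, Matrix.sub_mul, hU.mul_mul_of_ker_eq hA hUk, Matrix.mul_assoc Ud A,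
        hU.mul_mul_of_range_eq hA hUr]
      abel
    have hxe : ∀ i, x i = (Ud *ᵥ 1) i + ((Ud * V) *ᵥ x) i := fun i => by
      rw [hxdef, Matrix.mulVec_mulVec, ← Pi.add_apply, ← Matrix.add_mulVec, ← hmat]
    have hxpos : ∀ i, 0 < x i := fun i => by linarith [hUe i, hTx0 i, hxe i]
    have hθ : ∃ θ : ℝ, 0 ≤ θ ∧ θ < 1 ∧ ∀ i, ((Ud * V) *ᵥ x) i / x i ≤ θ := by
      rcases isEmpty_or_nonempty (Fin n) with h | h
      · exact ⟨0, le_rfl, one_pos, fun i => isEmptyElim i⟩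
      · obtain ⟨i, hi⟩ := Finite.exists_max fun i => ((Ud * V) *ᵥ x) i / x i
        refine ⟨_, div_nonneg (hTx0 i) (hx0 i), ?_, hi⟩
        rw [div_lt_one (hxpos i)]
        linarith [hUe i, hxe i]
    obtain ⟨θ, hθ0, hθ1, hθ⟩ := hθ
    exact (specRad_le_of_mulVec_le hT hxpos hθ0
      fun i => (div_le_iff₀ (hxpos i)).mp (hθ i)).trans_lt hθ1
  refine ⟨?_, hlt⟩
  have key : ∀ μ : ℝ, specRad (Ud * V) < μ → μ ≤ 1 → specRad (Bd * C) ≤ μ := by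
    intro μ hμ hμ1
    have hμ0 : 0 < μ := ENNReal.toReal_nonneg.trans_lt hμ
    set y : Fin n → ℝ := Ud *ᵥ 1 with hy
    have htend : Filter.Tendsto
        (fun N : ℕ => V *ᵥ (μ⁻¹ • ((μ⁻¹) ^ N • (Ud * V) ^ N) *ᵥ y)) Filter.atTop (nhds 0) := by
      have hc : Continuous fun M : Matrix (Fin n) (Fin n) ℝ => V *ᵥ (μ⁻¹ • M *ᵥ y) := by
        fun_prop
      have h0 := (hc.tendsto 0).comp (tendsto_inv_pow_smul_pow_of_specRad_lt hμ)
      rwa [Matrix.zero_mulVec, smul_zero, Matrix.mulVec_zero] at h0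
    have hev : ∀ᶠ N : ℕ in Filter.atTop, ∀ i,
        (V *ᵥ (μ⁻¹ • ((μ⁻¹) ^ N • (Ud * V) ^ N) *ᵥ y)) i < 1 :=
      Filter.eventually_all.mpr fun i =>
        ((tendsto_pi_nhds.mp htend) i).eventually_lt_const (by simp)
    obtain ⟨N, hN⟩ := hev.exists
    obtain ⟨x, hxy, hxe⟩ := exists_neumann_partial hT (fun i => (hUe i).le) hμ0 N
    set z := μ⁻¹ • ((μ⁻¹) ^ N • (Ud * V) ^ N) *ᵥ y
    set e : Fin m → ℝ := 1 - V *ᵥ z with he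
    have he0 : ∀ i, 0 ≤ e i := fun i => by
      have := hN i
      simp only [he, Pi.sub_apply, Pi.one_apply]
      linarith
    have hxpos : ∀ i, 0 < x i := fun i => (mul_pos (inv_pos.mpr hμ0) (hUe i)).trans_le (hxy i)
    have hxU : μ • x = Ud *ᵥ (V *ᵥ x + e) := by
      rw [hxe, he, hy, Matrix.mulVec_add, Matrix.mulVec_sub, Matrix.mulVec_mulVec,
        Matrix.mulVec_mulVec]
      abel
    have hx' : x = μ⁻¹ • Ud *ᵥ (V *ᵥ x + e) := by rw [← hxU, inv_smul_smul₀ hμ0.ne']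
    have hBBx : Bd *ᵥ (B *ᵥ x) = x := by
      rw [hx', Matrix.mulVec_smul, Matrix.mulVec_smul, Matrix.mulVec_mulVec, Matrix.mulVec_mulVec,
        hB.mul_mul_of_ker_eq hU (hBk.trans hUk.symm), ← hx']
    have hBUx : μ • Bd *ᵥ (U *ᵥ x) = Bd *ᵥ (V *ᵥ x + e) := by
      rw [← Matrix.mulVec_smul, ← Matrix.mulVec_smul, hxU, Matrix.mulVec_mulVec,
        Matrix.mulVec_mulVec, Matrix.mul_assoc, hB.mul_mul_of_range_eq hU (hBr.trans hUr.symm)]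
    have hCx : (Bd * C) *ᵥ x = x - Bd *ᵥ (U *ᵥ x) + Bd *ᵥ (V *ᵥ x) := by
      have hC : C = B - U + V := by
        have : C = B - A := by rw [hAB]; abel
        rw [this, hAU]; abel
      rw [← Matrix.mulVec_mulVec, hC, Matrix.add_mulVec, Matrix.sub_mulVec, Matrix.mulVec_add,
        Matrix.mulVec_sub, hBBx]
    have hVx : ∀ i, 0 ≤ (V *ᵥ x) i := fun i =>
      mulVec_apply_nonneg hV (fun j => (hxpos j).le) i
    have hmono : ∀ w : Fin m → ℝ, (∀ i, 0 ≤ w i) → ∀ i, (Ud *ᵥ w) i ≤ (Bd *ᵥ w) i :=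
      fun w hw i => by
      have := mulVec_apply_nonneg (M := Bd - Ud) (fun i j => sub_nonneg.mpr (hcomp i j)) hw i
      rwa [Matrix.sub_mulVec, Pi.sub_apply, sub_nonneg] at this
    refine specRad_le_of_mulVec_le hBC hxpos hμ0.le fun i => ?_
    have h1 := hmono _ hVx i
    have h2 := hmono _ he0 i
    have h3 := congrFun hxU i
    have h4 := congrFun hBUx i
    have h5 := congrFun hCx i
    have h6 : 0 ≤ (Ud *ᵥ e) i := mulVec_apply_nonneg hUd he0 i
    simp only [Matrix.mulVec_add, Pi.add_apply, Pi.sub_apply, Pi.smul_apply, smul_eq_mul]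
      at h3 h4 h5
    refine le_of_mul_le_mul_left ?_ hμ0
    rw [h5]
    nlinarith [mul_nonneg (sub_nonneg.mpr hμ1) (sub_nonneg.mpr h1)]
  refine le_of_forall_gt_imp_ge_of_dense fun μ hμ => ?_
  exact (key (min μ 1) (lt_min hμ hlt) (min_le_right _ _)).trans (min_le_left _ _)
end

section
/- Let A = M − N = U − V be two proper weak regular splittings of a real m×n semi-monotone matrix A (A† ≥ 0), and set H = U†V M†N. Then HA† ≤ A† entrywise; equivalently, (I − H)A† ≥ 0. -/
open Matrix

theorem Matrix.mul_eq_of_ker_le {m n : ℕ} {A B : Matrix (Fin m) (Fin n) ℝ}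
    {G : Matrix (Fin n) (Fin m) ℝ} (hG : A * G * A = A)
    (h : LinearMap.ker A.mulVecLin ≤ LinearMap.ker B.mulVecLin) : B * (G * A) = B := by
  refine Matrix.ext_of_mulVec_single fun i => ?_
  set x : Fin n → ℝ := Pi.single i 1
  have hx : (G * A) *ᵥ x - x ∈ LinearMap.ker A.mulVecLin := by
    simp [Matrix.mulVec_sub, Matrix.mulVec_mulVec, ← Matrix.mul_assoc, hG]
  have hB := h hx
  simp only [LinearMap.mem_ker, Matrix.mulVecLin_apply, Matrix.mulVec_sub,
    Matrix.mulVec_mulVec] at hB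
  exact sub_eq_zero.mp hB

theorem Matrix.mul_eq_of_range_le {m n : ℕ} {A B : Matrix (Fin m) (Fin n) ℝ}
    {G : Matrix (Fin n) (Fin m) ℝ} (hG : A * G * A = A)
    (h : LinearMap.range B.mulVecLin ≤ LinearMap.range A.mulVecLin) : A * G * B = B := by
  refine Matrix.ext_of_mulVec_single fun i => ?_
  set x : Fin n → ℝ := Pi.single i 1
  obtain ⟨y, hy⟩ := h (LinearMap.mem_range_self B.mulVecLin x)
  simp only [Matrix.mulVecLin_apply] at hy
  rw [← Matrix.mulVec_mulVec, ← hy, Matrix.mulVec_mulVec, hG]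

theorem IsMoorePenrose.mul_eq_of_ker_eq {m n : ℕ} {A B : Matrix (Fin m) (Fin n) ℝ}
    {G K : Matrix (Fin n) (Fin m) ℝ} (hA : IsMoorePenrose A G) (hB : IsMoorePenrose B K)
    (h : LinearMap.ker B.mulVecLin = LinearMap.ker A.mulVecLin) : K * B = G * A := by
  have h₁ : K * B * (G * A) = K * B := by
    rw [Matrix.mul_assoc, Matrix.mul_eq_of_ker_le hA.1 h.ge]
  have h₂ : G * A * (K * B) = G * A := by
    rw [Matrix.mul_assoc, Matrix.mul_eq_of_ker_le hB.1 h.le]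
  have h₃ := congrArg Matrix.transpose h₁
  rw [Matrix.transpose_mul, hA.2.2.2, hB.2.2.2] at h₃
  exact h₃.symm.trans h₂

theorem IsMoorePenrose.mul_eq_of_range_eq {m n : ℕ} {A B : Matrix (Fin m) (Fin n) ℝ}
    {G K : Matrix (Fin n) (Fin m) ℝ} (hA : IsMoorePenrose A G) (hB : IsMoorePenrose B K)
    (h : LinearMap.range B.mulVecLin = LinearMap.range A.mulVecLin) : B * K = A * G := by
  have h₁ : A * G * (B * K) = B * K := by
    rw [← Matrix.mul_assoc, Matrix.mul_eq_of_range_le hA.1 h.le]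
  have h₂ : B * K * (A * G) = A * G := by
    rw [← Matrix.mul_assoc, Matrix.mul_eq_of_range_le hB.1 h.ge]
  have h₃ := congrArg Matrix.transpose h₁
  rw [Matrix.transpose_mul, hA.2.2.1, hB.2.2.1] at h₃
  exact h₃.symm.trans h₂

theorem IsProperSplitting.mul_mul_eq_sub {m n : ℕ} {A U V : Matrix (Fin m) (Fin n) ℝ}
    {Ad Ud : Matrix (Fin n) (Fin m) ℝ} (h : IsProperSplitting A U V)
    (hA : IsMoorePenrose A Ad) (hU : IsMoorePenrose U Ud) :
    Ud * V * Ad = Ad - Ud := by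
  obtain ⟨hAUV, hr, hk⟩ := h
  have hV : V = U - A := by rw [hAUV]; abel
  rw [hV, Matrix.mul_sub, Matrix.sub_mul, hA.mul_eq_of_ker_eq hU hk, hA.2.1,
    Matrix.mul_assoc Ud A Ad, ← hA.mul_eq_of_range_eq hU hr, ← Matrix.mul_assoc, hU.2.1]

theorem stmt14 {m n : ℕ} (A M N U V : Matrix (Fin m) (Fin n) ℝ)
    (Ad Md Ud : Matrix (Fin n) (Fin m) ℝ)
    (hA : IsMoorePenrose A Ad) (hM : IsMoorePenrose M Md) (hU : IsMoorePenrose U Ud)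
    (hsemi : ∀ i j, 0 ≤ Ad i j)
    -- A = M - N is a proper weak regular splitting
    (hPSM : IsProperSplitting A M N)
    (hMd : ∀ i j, 0 ≤ Md i j) (hMN : ∀ i j, 0 ≤ (Md * N) i j)
    -- A = U - V is a proper weak regular splitting
    (hPSU : IsProperSplitting A U V)
    (hUd : ∀ i j, 0 ≤ Ud i j) (hUV : ∀ i j, 0 ≤ (Ud * V) i j) :
    (∀ i j, (Ud * V * (Md * N) * Ad) i j ≤ Ad i j) ∧
      (∀ i j, 0 ≤ (((1 : Matrix (Fin n) (Fin n) ℝ) - Ud * V * (Md * N)) * Ad) i j) := by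
  have hH : Ud * V * (Md * N) * Ad = Ad - (Ud + Ud * V * Md) := by
    rw [Matrix.mul_assoc, hPSM.mul_mul_eq_sub hA hM, Matrix.mul_sub,
      hPSU.mul_mul_eq_sub hA hU]
    abel
  have hpos : ∀ i j, 0 ≤ (Ud + Ud * V * Md) i j := fun i j =>
    add_nonneg (hUd i j) <| by
      rw [Matrix.mul_apply]
      exact Finset.sum_nonneg fun k _ => mul_nonneg (hUV i k) (hMd k j)
  refine ⟨fun i j => ?_, fun i j => ?_⟩
  · rw [hH, Matrix.sub_apply]
    exact sub_le_self _ (hpos i j)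
  · rw [Matrix.sub_mul, Matrix.one_mul, hH, sub_sub_cancel]
    exact hpos i j
end
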